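/- Let G be a countable group, M ⊆ G a finite subset, A a finite set, and S = A^(A^M). If σ_s is stably injective for some s ∈ S^G, then σ_s is reversible, i.e., there exist a finite subset N ⊆ G and q ∈ (A^(A^N))^G such that σ_q ∘ σ_s = Id. -/

import Mathlib

open Pointwise

section ANUCA

variable {G : Type*} [Group G] {A : Type*}

/-- The shift action of `G` on configurations: `(g · x) h = x (g⁻¹ * h)`. -/
def shiftC {S : Type*} (g : G) (x : G → S) : G → S := fun h => x (g⁻¹ * h)

/-- The prodiscrete topology on `G → S` (product topology, `S` discrete). -/
def prodiscrete (G S : Type*) : TopologicalSpace (G → S) :=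
  @Pi.topologicalSpace G (fun _ => S) (fun _ => ⊥)

/-- `Σ(s)`: the closure of the shift orbit of `s` in the prodiscrete topology. -/
def orbitClosure {S : Type*} (s : G → S) : Set (G → S) :=
  @closure _ (prodiscrete G S) {p | ∃ g : G, shiftC g s = p}

/-- The ANUCA `σ_s` with memory `M` associated with the configuration of local
defining maps `s : G → (A^M → A)`, namely `σ_s x g = s g ((g⁻¹ · x)|_M)`. -/
def anuca (M : Set G) (s : G → ((M → A) → A)) (x : G → A) : G → A :=
  fun g => s g (fun m => x (g * (m : G)))

/-- `σ_s` is stably injective if `σ_p` is injective for every `p ∈ Σ(s)`. -/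
def StablyInjective (M : Set G) (s : G → ((M → A) → A)) : Prop :=
  ∀ p ∈ orbitClosure s, Function.Injective (anuca M p)

/-- `σ_s` is reversible if `σ_w ∘ σ_s = Id` for some ANUCA `σ_w` with finite memory. -/
def Reversible (M : Set G) (s : G → ((M → A) → A)) : Prop :=
  ∃ N : Set G, N.Finite ∧ ∃ w : G → ((N → A) → A), anuca N w ∘ anuca M s = id

/-- `σ_s` is stably reversible if there are a finite `N ⊆ G` and `q ∈ T^G`,
`T = A^(A^N)`, such that every `p ∈ Σ(s)` admits `w ∈ Σ(q)` with `σ_w ∘ σ_p = Id`. -/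
def StablyReversible (M : Set G) (s : G → ((M → A) → A)) : Prop :=
  ∃ N : Set G, N.Finite ∧ ∃ q : G → ((N → A) → A),
    ∀ p ∈ orbitClosure s, ∃ w ∈ orbitClosure q, anuca N w ∘ anuca M p = id

/-- `σ_s` is invertible if it is bijective and its inverse is an ANUCA with finite memory. -/
def InvertibleANUCA (M : Set G) (s : G → ((M → A) → A)) : Prop :=
  Function.Bijective (anuca M s) ∧
    ∃ N : Set G, N.Finite ∧ ∃ w : G → ((N → A) → A),
      anuca N w ∘ anuca M s = id ∧ anuca M s ∘ anuca N w = id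

/-- Two configurations are asymptotic if they agree outside a finite set. -/
def Asymptotic {S : Type*} (x y : G → S) : Prop := {g : G | x g ≠ y g}.Finite

/-- A map `τ : A^G → A^G` is pre-injective if it is injective on asymptotic pairs. -/
def PreInjective (τ : (G → A) → (G → A)) : Prop :=
  ∀ x y : G → A, Asymptotic x y → τ x = τ y → x = y

/-- A map `τ : A^G → A^G` is post-surjective if every configuration asymptotic to
`τ x` is the image of a configuration asymptotic to `x`. -/
def PostSurjective (τ : (G → A) → (G → A)) : Prop :=
  ∀ x y : G → A, Asymptotic y (τ x) → ∃ z : G → A, Asymptotic z x ∧ τ z = y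

end ANUCA

/-- The local rule at `g`, with rules indexed by a finite discrete type, depends continuously on
the configuration of rules and the configuration. -/
theorem continuous_localRule {G S A : Type*} [Group G] [TopologicalSpace S] [DiscreteTopology S]
    [TopologicalSpace A] [DiscreteTopology A] {M : Set G} [Finite M]
    (e : S → (M → A) → A) (g : G) :
    Continuous fun q : (G → S) × (G → A) => e (q.1 g) (fun m => q.2 (g * (m : G))) :=
  (continuous_of_discreteTopology (f := fun r : S × (M → A) => e r.1 r.2)).comp
    (f := fun q : (G → S) × (G → A) => (q.1 g, fun m : M => q.2 (g * (m : G)))) (by fun_prop)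

/-- If every rule configuration in a closed set induces an injective map, then finitely many
values of the image determine the value at `1`, uniformly over the closed set. -/
theorem exists_finset_determining_one {G S A : Type*} [Group G] [Finite S] [Finite A]
    {M : Set G} [Finite M] (e : S → (M → A) → A) (P : Set (G → S))
    (hP : @IsClosed _ (prodiscrete G S) P)
    (hinj : ∀ p ∈ P, Function.Injective (anuca M fun g => e (p g))) :
    ∃ N : Finset G, ∀ p ∈ P, ∀ x y : G → A,
      (∀ g ∈ N, anuca M (fun g => e (p g)) x g = anuca M (fun g => e (p g)) y g) →
        x 1 = y 1 := by
  let : TopologicalSpace S := ⊥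
  let : TopologicalSpace A := ⊥
  have : DiscreteTopology S := ⟨rfl⟩
  have : DiscreteTopology A := ⟨rfl⟩
  have hP' : IsClosed P := hP
  let C : Set ((G → S) × (G → A) × (G → A)) := {q | q.1 ∈ P ∧ q.2.1 1 ≠ q.2.2 1}
  let F : G → Set ((G → S) × (G → A) × (G → A)) := fun g =>
    {q | e (q.1 g) (fun m => q.2.1 (g * (m : G))) = e (q.1 g) (fun m => q.2.2 (g * (m : G)))}
  have hC : IsClosed C := by
    refine (hP'.preimage continuous_fst).inter ?_
    exact (isClosed_discrete {r : A × A | r.1 ≠ r.2}).preimage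
      (f := fun q : (G → S) × (G → A) × (G → A) => (q.2.1 1, q.2.2 1)) (by fun_prop)
  have hF : ∀ g, IsClosed (F g) := fun g =>
    isClosed_eq
      ((continuous_localRule e g).comp
        (f := fun q : (G → S) × (G → A) × (G → A) => (q.1, q.2.1)) (by fun_prop))
      ((continuous_localRule e g).comp
        (f := fun q : (G → S) × (G → A) × (G → A) => (q.1, q.2.2)) (by fun_prop))
  have hempty : C ∩ ⋂ g, F g = ∅ := by
    refine Set.eq_empty_of_forall_notMem ?_
    rintro ⟨p, x, y⟩ ⟨⟨hp, hne⟩, hall⟩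
    exact hne (congrFun (hinj p hp (funext fun g => Set.mem_iInter.1 hall g)) 1)
  obtain ⟨N, hN⟩ := hC.isCompact.elim_finite_subfamily_closed F hF hempty
  refine ⟨N, fun p hp x y hxy => ?_⟩
  by_contra hne
  exact Set.eq_empty_iff_forall_notMem.1 hN (p, x, y)
    ⟨⟨hp, hne⟩, Set.mem_iInter₂.2 hxy⟩

/-- Shifting commutes with applying an ANUCA, up to shifting its rules. -/
theorem anuca_shiftC {G A : Type*} [Group G] (M : Set G) (s : G → (M → A) → A) (g : G)
    (x : G → A) : anuca M (shiftC g s) (shiftC g x) = shiftC g (anuca M s x) := by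
  funext h
  simp only [anuca, shiftC, mul_assoc]

/-- An ANUCA is reversible as soon as each value `x g` is determined by the image of `x` on the
translate `g N` of a fixed finite set. -/
theorem Reversible.of_determined {G A : Type*} [Group G] {M : Set G} {s : G → (M → A) → A}
    (N : Finset G)
    (hN : ∀ (g : G) (x y : G → A),
      (∀ n ∈ N, anuca M s x (g * n) = anuca M s y (g * n)) → x g = y g) :
    Reversible M s := by
  classical
  let N' : Set G := ↑(insert 1 N)
  have h1 : (1 : G) ∈ N' := Finset.mem_coe.2 (Finset.mem_insert_self 1 N)
  let w : G → (N' → A) → A := fun g f =>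
    if hf : ∃ x : G → A, ∀ n : N', anuca M s x (g * n) = f n then hf.choose g else f ⟨1, h1⟩
  refine ⟨N', Finset.finite_toSet _, w, ?_⟩
  funext x g
  have hf : ∃ y : G → A, ∀ n : N', anuca M s y (g * n) = anuca M s x (g * n) :=
    ⟨x, fun _ => rfl⟩
  change (if hf : ∃ y : G → A, ∀ n : N', anuca M s y (g * n) = anuca M s x (g * n)
    then hf.choose g else _) = x g
  rw [dif_pos hf]
  exact hN g _ _ fun n hn =>
    hf.choose_spec ⟨n, Finset.mem_coe.2 (Finset.mem_insert_of_mem hn)⟩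

/-- Over a countable group and finite alphabet, every stably injective ANUCA with finite
memory is reversible. -/
theorem stmt14 {G A : Type*} [Group G] [Countable G] [Finite A]
    (M : Set G) (hM : M.Finite) (s : G → ((M → A) → A))
    (h : StablyInjective M s) :
    Reversible M s := by
  have : Finite M := hM
  obtain ⟨N, hN⟩ := exists_finset_determining_one (S := (M → A) → A) id (orbitClosure s)
    (@isClosed_closure _ (prodiscrete G _) _) h
  refine .of_determined N fun g x y hxy => ?_
  have hmem : shiftC g⁻¹ s ∈ orbitClosure s :=
    @subset_closure _ (prodiscrete G _) _ _ ⟨g⁻¹, rfl⟩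
  have key := hN _ hmem (shiftC g⁻¹ x) (shiftC g⁻¹ y) fun n hn => by
    change anuca M (shiftC g⁻¹ s) _ n = anuca M (shiftC g⁻¹ s) _ n
    simpa only [anuca_shiftC, shiftC, inv_inv] using hxy n hn
  simpa only [shiftC, inv_inv, mul_one] using key
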